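/- Let F_q be a finite field with q elements, q ≡ −1 (mod 3), and let L/F_q(x) be a Galois field extension of degree 3 with a primitive element z whose minimal polynomial is X^3 − 3X − a, where a = P/Q with P, Q ∈ F_q[x] coprime. Then deg P ≤ deg Q; equivalently, a has no pole at the place at infinity of F_q(x) (the infinite valuation of a is nonnegative). -/

import Mathlib

open Polynomial

/-- Over a finite field with `q ≡ 2 (mod 3)` the form `c² + pc + p²` is anisotropic. -/
theorem FiniteField.eq_zero_of_sq_add_mul_add_sq_eq_zero {F : Type*} [Field F] [Fintype F]
    (hq : Fintype.card F % 3 = 2) {c p : F} (h : c ^ 2 + p * c + p ^ 2 = 0) : p = 0 := by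
  by_contra hp
  have h3 : (3 : F) ≠ 0 := by
    intro h3
    have hcard : (Fintype.card F : F) = 0 := Nat.cast_card_eq_zero F
    rw [← Nat.div_add_mod (Fintype.card F) 3, hq] at hcard
    push_cast at hcard
    rw [h3, zero_mul, zero_add] at hcard
    exact one_ne_zero (α := F) (by linear_combination h3 - hcard)
  have hu : (c / p) ^ 3 = 1 := by
    field_simp
    linear_combination (c - p) * h
  have hu0 : c / p ≠ 0 := fun h0 => by simp [h0] at hu
  have hcop : Nat.Coprime 3 (Fintype.card F - 1) :=
    (Nat.Prime.coprime_iff_not_dvd Nat.prime_three).2 (by omega)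
  have h1 : c / p = 1 := orderOf_eq_one_iff.1 <| Nat.eq_one_of_dvd_coprimes hcop
    (orderOf_dvd_of_pow_eq_one hu)
    (orderOf_dvd_of_pow_eq_one (FiniteField.pow_card_sub_one_eq_one _ hu0))
  obtain rfl : c = p := by rwa [div_eq_one_iff_eq hp] at h1
  have : 3 * c ^ 2 = 0 := by linear_combination h
  simp_all

/-- Comparison of the leading coefficients in `W² + PW + P² = 3Q²`. -/
theorem Polynomial.natDegree_le_of_sq_add_mul_add_sq {F : Type*} [Field F] [Fintype F]
    (hq : Fintype.card F % 3 = 2) {P Q W : F[X]}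
    (h : W ^ 2 + P * W + P ^ 2 = 3 * Q ^ 2) : P.natDegree ≤ Q.natDegree := by
  by_contra! hlt
  set N := max P.natDegree W.natDegree
  have hP : P.natDegree ≤ N := le_max_left _ _
  have hW : W.natDegree ≤ N := le_max_right _ _
  have hcoeff := congrArg (fun f => f.coeff (N + N)) h
  have hQ : (3 * Q ^ 2).coeff (N + N) = 0 := by
    apply coeff_eq_zero_of_natDegree_lt
    have h1 : (3 * Q ^ 2).natDegree ≤ (3 : F[X]).natDegree + (Q ^ 2).natDegree :=
      natDegree_mul_le
    have h2 : (Q ^ 2).natDegree ≤ 2 * Q.natDegree := natDegree_pow_le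
    have h3 : (3 : F[X]).natDegree = 0 := natDegree_ofNat 3
    omega
  simp only [hQ] at hcoeff
  simp only [sq W, sq P, coeff_add, coeff_mul_add_eq_of_natDegree_le hW hW,
    coeff_mul_add_eq_of_natDegree_le hP hW, coeff_mul_add_eq_of_natDegree_le hP hP] at hcoeff
  have hp : P.coeff N = 0 := FiniteField.eq_zero_of_sq_add_mul_add_sq_eq_zero hq
    (c := W.coeff N) (by linear_combination hcoeff)
  have hc : W.coeff N = 0 := FiniteField.eq_zero_of_sq_add_mul_add_sq_eq_zero hq
    (c := P.coeff N) (by linear_combination hcoeff)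
  rcases max_choice P.natDegree W.natDegree with hN | hN
  · have : P = 0 := by
      rw [← leadingCoeff_eq_zero, leadingCoeff, ← hN]
      exact hp
    simp [this] at hlt
  · have : W = 0 := by
      rw [← leadingCoeff_eq_zero, leadingCoeff, ← hN]
      exact hc
    simp [this] at hN
    omega

/-- In an extension of odd degree, a root of a monic quadratic lies in the base field. -/
theorem mem_range_algebraMap_of_quadratic_of_odd_finrank {K L : Type*} [Field K] [Field L]
    [Algebra K L] [FiniteDimensional K L] (hodd : Odd (Module.finrank K L)) {w : L} (b c : K)
    (hw : w ^ 2 + algebraMap K L b * w + algebraMap K L c = 0) :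
    w ∈ (algebraMap K L).range := by
  have hint : IsIntegral K w := .of_finite K w
  rw [← minpoly.natDegree_eq_one_iff]
  have hmonic : (X ^ 2 + C b * X + C c : K[X]).Monic := by monicity!
  have hdeg : (X ^ 2 + C b * X + C c : K[X]).natDegree = 2 := by compute_degree!
  have hle : (minpoly K w).natDegree ≤ 2 := hdeg ▸ natDegree_le_of_dvd
    (minpoly.dvd K w (by simpa using hw)) hmonic.ne_zero
  have hpos := minpoly.natDegree_pos hint
  have hodd' : Odd (minpoly K w).natDegree := hodd.of_dvd_nat (minpoly.degree_dvd hint)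
  obtain ⟨k, hk⟩ := hodd'
  omega

/-- In a Galois cubic extension generated by a root of `X³ - 3X - a`, the quadratic resolvent
`Y² + aY + a² - 3` has a root in the base field. -/
theorem exists_root_resolvent_of_isGalois {K L : Type*} [Field K] [Field L] [Algebra K L]
    [IsGalois K L] (hdeg : Module.finrank K L = 3) {z : L} {a : K}
    (hz : IntermediateField.adjoin K {z} = ⊤) (hroot : z ^ 3 - 3 * z - algebraMap K L a = 0) :
    ∃ w : K, w ^ 2 + a * w + (a ^ 2 - 3) = 0 := by
  have : FiniteDimensional K L := Module.finite_of_finrank_pos (by omega)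
  have hcard : Nat.card (L ≃ₐ[K] L) = 3 := by rw [IsGalois.card_aut_eq_finrank, hdeg]
  have : Nontrivial (L ≃ₐ[K] L) := Finite.one_lt_card_iff_nontrivial.1 (by omega)
  obtain ⟨σ, hσ⟩ := exists_ne (1 : L ≃ₐ[K] L)
  have hne : z - σ z ≠ 0 := by
    intro h
    refine hσ (AlgEquiv.coe_toAlgHom_injective ?_)
    refine AlgHom.ext_of_adjoin_eq_top
      ((IntermediateField.adjoin_eq_top_iff_of_isAlgebraic fun x _ => .of_finite K x).1 hz) ?_
    rintro x rfl
    simpa using (sub_eq_zero.1 h).symm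
  have hroot' : σ z ^ 3 - 3 * σ z - algebraMap K L a = 0 := by
    simpa [map_ofNat σ 3] using congrArg σ hroot
  have hquad : z ^ 2 + z * σ z + σ z ^ 2 - 3 = 0 :=
    (mul_eq_zero.1 (by linear_combination hroot - hroot' :
      (z - σ z) * (z ^ 2 + z * σ z + σ z ^ 2 - 3) = 0)).resolve_left hne
  have hw : (z ^ 2 * σ z + z - σ z) ^ 2 + algebraMap K L a * (z ^ 2 * σ z + z - σ z)
      + algebraMap K L (a ^ 2 - 3) = 0 := by
    simp only [map_sub, map_pow, map_ofNat]
    grind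
  obtain ⟨w, hw'⟩ := mem_range_algebraMap_of_quadratic_of_odd_finrank (by rw [hdeg]; decide) _ _ hw
  refine ⟨w, (algebraMap K L).injective ?_⟩
  rw [← hw'] at hw
  simpa using hw

/-- Let F_q be a finite field with q ≡ −1 (mod 3), and let L/F_q(x) be a Galois field
extension of degree 3 with a primitive element z whose minimal polynomial is
X^3 − 3X − a, where a = P/Q with P, Q ∈ F_q[x] coprime. Then deg P ≤ deg Q, i.e. a has
no pole at the place at infinity of F_q(x). -/
theorem no_pole_at_infinity
    (F : Type*) [Field F] [Fintype F]
    (hq : Fintype.card F % 3 = 2)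
    (L : Type*) [Field L] [Algebra (RatFunc F) L]
    [IsGalois (RatFunc F) L]
    (hdeg : Module.finrank (RatFunc F) L = 3)
    (z : L) (P Q : Polynomial F)
    (hz : IntermediateField.adjoin (RatFunc F) {z} = ⊤)
    (hPQ : IsCoprime P Q)
    (hmin : minpoly (RatFunc F) z =
      X ^ 3 - 3 * X -
        C (algebraMap (Polynomial F) (RatFunc F) P /
           algebraMap (Polynomial F) (RatFunc F) Q)) :
    P.degree ≤ Q.degree := by
  have : FiniteDimensional (RatFunc F) L := Module.finite_of_finrank_pos (by omega)
  have hroot := minpoly.aeval (RatFunc F) z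
  rw [hmin] at hroot
  simp only [map_sub, map_mul, map_pow, aeval_X, aeval_C, map_ofNat] at hroot
  have hQ : Q ≠ 0 := by
    rintro rfl
    have hirr : Irreducible (minpoly (RatFunc F) z) := minpoly.irreducible (.of_finite _ z)
    have h0 : (minpoly (RatFunc F) z).IsRoot 0 := by simp [hmin, IsRoot]
    have h1 := degree_eq_one_of_irreducible_of_root hirr h0
    have h3 : (minpoly (RatFunc F) z).degree = 3 := by
      rw [hmin]
      compute_degree!
    rw [h1] at h3
    exact absurd h3 (by decide)
  obtain ⟨w, hw⟩ := exists_root_resolvent_of_isGalois hdeg hz hroot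
  set i := algebraMap F[X] (RatFunc F)
  have hinj : Function.Injective i := IsFractionRing.injective F[X] (RatFunc F)
  have hiQ : i Q ≠ 0 := (map_ne_zero_iff i hinj).2 hQ
  have hv : (i Q * w) ^ 2 + i P * (i Q * w) + (i P ^ 2 - 3 * i Q ^ 2) = 0 := by
    have ha : i P / i Q * i Q = i P := div_mul_cancel₀ _ hiQ
    generalize i P / i Q = a at hw ha
    rw [← ha]
    linear_combination i Q ^ 2 * hw
  have hint : IsIntegral F[X] (i Q * w) := by
    refine ⟨X ^ 2 + C P * X + C (P ^ 2 - 3 * Q ^ 2), by monicity!, ?_⟩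
    simpa [i, map_ofNat (algebraMap F[X] (RatFunc F)) 3] using hv
  obtain ⟨W, hW⟩ := IsIntegrallyClosed.algebraMap_eq_of_integral hint
  rw [← hW] at hv
  have hpoly : W ^ 2 + P * W + P ^ 2 = 3 * Q ^ 2 := hinj <| by
    simp only [map_add, map_mul, map_pow, map_ofNat]
    linear_combination hv
  rw [degree_eq_natDegree hQ]
  exact natDegree_le_iff_degree_le.1 (natDegree_le_of_sq_add_mul_add_sq hq hpoly)
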